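/- Suppose g'(u) ≠ 0 for all u ∈ I. Then the meridian surface M² has pointwise 1-type Gauss map of the first kind (ΔG = λ G for some smooth nowhere-zero λ) if and only if one of the following holds: (i) κ ≡ 0 (the curve r is a great circle) and the meridian curve satisfies the differential equation f' g' − f (f κ_α)' = 0, which for g' = √(1 − f'²) reads f'√(1 − f'²) + f (f f''/√(1 − f'²))' = 0; or (ii) κ is a non-zero constant and f(u) = a, g(u) = ±u + b for constants a ≠ 0 and b. In case (ii) λ = (1 + κ²)/a² is constant, so M² has (global) 1-type Gauss map and is non-proper. -/

import Mathlib

open Matrix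

noncomputable section

/-- The embedding of `ℝ³ = span{e₁,e₂,e₃}` into `ℝ⁴`. -/
def emb (p : Fin 3 → ℝ) : Fin 4 → ℝ := ![p 0, p 1, p 2, 0]

/-- The fourth standard basis vector `e₄` of `ℝ⁴`. -/
def e4 : Fin 4 → ℝ := ![0, 0, 0, 1]

/-- Model of the bivector `a ∧ b ∈ Λ²ℝ⁴` as the antisymmetric matrix `aᵢbⱼ − aⱼbᵢ`. -/
def wedge (a b : Fin 4 → ℝ) : Fin 4 → Fin 4 → ℝ := fun i j => a i * b j - a j * b i

/-- The tangent `t = r'` of the spherical curve `r`. -/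
def sphT (r : ℝ → Fin 3 → ℝ) : ℝ → Fin 3 → ℝ := deriv r

/-- The normal `n = r × t` of the spherical curve `r`. -/
def sphN (r : ℝ → Fin 3 → ℝ) (v : ℝ) : Fin 3 → ℝ := crossProduct (r v) (deriv r v)

/-- The spherical curvature `κ = ⟨t', n⟩` of the spherical curve `r`. -/
def sphCurv (r : ℝ → Fin 3 → ℝ) (v : ℝ) : ℝ := deriv (deriv r) v ⬝ᵥ sphN r v

/-- The curvature `κ_α = f′g″ − g′f″` of the meridian curve `α = (f, g)`. -/
def merCurv (f g : ℝ → ℝ) (u : ℝ) : ℝ :=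
  deriv f u * deriv (deriv g) u - deriv g u * deriv (deriv f) u

/-- The parametrization `z(u,v) = f(u) r(v) + g(u) e₄` of the meridian surface `M²`. -/
def mz (f g : ℝ → ℝ) (r : ℝ → Fin 3 → ℝ) (u v : ℝ) : Fin 4 → ℝ :=
  f u • emb (r v) + g u • e4

/-- The tangent frame vector `x = ∂z/∂u = f′ r + g′ e₄`. -/
def mx (f g : ℝ → ℝ) (r : ℝ → Fin 3 → ℝ) (u v : ℝ) : Fin 4 → ℝ :=
  deriv f u • emb (r v) + deriv g u • e4

/-- The tangent frame vector `y = (1/f) ∂z/∂v = t`. -/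
def my (r : ℝ → Fin 3 → ℝ) (v : ℝ) : Fin 4 → ℝ := emb (deriv r v)

/-- The normal frame vector `n₁ = n`. -/
def mn1 (r : ℝ → Fin 3 → ℝ) (v : ℝ) : Fin 4 → ℝ := emb (sphN r v)

/-- The normal frame vector `n₂ = −g′ r + f′ e₄`. -/
def mn2 (f g : ℝ → ℝ) (r : ℝ → Fin 3 → ℝ) (u v : ℝ) : Fin 4 → ℝ :=
  (-(deriv g u)) • emb (r v) + deriv f u • e4

/-- The Gauss map `G = x ∧ y` of the meridian surface, with values in `Λ²ℝ⁴`. -/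
def gaussG (f g : ℝ → ℝ) (r : ℝ → Fin 3 → ℝ) (u v : ℝ) : Fin 4 → Fin 4 → ℝ :=
  wedge (mx f g r u v) (my r v)

/-- The Laplacian `Δφ = −(∂²φ/∂u² + (1/f²) ∂²φ/∂v² + (f′/f) ∂φ/∂u)` of the meridian
surface, acting on `Λ²ℝ⁴`-valued functions. -/
def surfLap (f : ℝ → ℝ) (φ : ℝ → ℝ → Fin 4 → Fin 4 → ℝ) (u v : ℝ) : Fin 4 → Fin 4 → ℝ :=
  -(deriv (deriv (fun s => φ s v)) u + (1 / f u ^ 2) • deriv (deriv (fun s => φ u s)) v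
    + (deriv f u / f u) • deriv (fun s => φ s v) u)

/-- `h(x,x)`: the normal component (w.r.t. `{n₁, n₂}`) of `∇′ₓx = ∂x/∂u`. -/
def hxx (f g : ℝ → ℝ) (r : ℝ → Fin 3 → ℝ) (u v : ℝ) : Fin 4 → ℝ :=
  (deriv (fun s => mx f g r s v) u ⬝ᵥ mn1 r v) • mn1 r v
    + (deriv (fun s => mx f g r s v) u ⬝ᵥ mn2 f g r u v) • mn2 f g r u v

/-- `h(x,y)`: the normal component (w.r.t. `{n₁, n₂}`) of `∇′_y x = (1/f) ∂x/∂v`. -/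
def hxy (f g : ℝ → ℝ) (r : ℝ → Fin 3 → ℝ) (u v : ℝ) : Fin 4 → ℝ :=
  (((1 / f u) • deriv (fun s => mx f g r u s) v) ⬝ᵥ mn1 r v) • mn1 r v
    + (((1 / f u) • deriv (fun s => mx f g r u s) v) ⬝ᵥ mn2 f g r u v) • mn2 f g r u v

/-- `h(y,y)`: the normal component (w.r.t. `{n₁, n₂}`) of `∇′_y y = (1/f) ∂y/∂v`. -/
def hyy (f g : ℝ → ℝ) (r : ℝ → Fin 3 → ℝ) (u v : ℝ) : Fin 4 → ℝ :=
  (((1 / f u) • deriv (my r) v) ⬝ᵥ mn1 r v) • mn1 r v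
    + (((1 / f u) • deriv (my r) v) ⬝ᵥ mn2 f g r u v) • mn2 f g r u v

/-! ### Algebra of the orthonormal frame -/

lemma emb_dotProduct_emb (p q : Fin 3 → ℝ) : emb p ⬝ᵥ emb q = p ⬝ᵥ q := by
  simp [emb, dotProduct, Fin.sum_univ_succ]

lemma emb_dotProduct_e4 (p : Fin 3 → ℝ) : emb p ⬝ᵥ e4 = 0 := by
  simp [emb, e4, dotProduct, Fin.sum_univ_succ]

lemma e4_dotProduct_emb (p : Fin 3 → ℝ) : e4 ⬝ᵥ emb p = 0 := by
  rw [dotProduct_comm, emb_dotProduct_e4]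

lemma e4_dotProduct_e4 : e4 ⬝ᵥ e4 = 1 := by
  simp [e4, dotProduct, Fin.sum_univ_succ]

lemma emb_add (p q : Fin 3 → ℝ) : emb (p + q) = emb p + emb q := by
  ext i; fin_cases i <;> simp [emb]

lemma emb_smul (c : ℝ) (p : Fin 3 → ℝ) : emb (c • p) = c • emb p := by
  ext i; fin_cases i <;> simp [emb]

lemma wedge_add_left (a b c : Fin 4 → ℝ) : wedge (a + b) c = wedge a c + wedge b c := by
  ext i j; simp [wedge]; ring

lemma wedge_add_right (a b c : Fin 4 → ℝ) : wedge a (b + c) = wedge a b + wedge a c := by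
  ext i j; simp [wedge]; ring

lemma wedge_smul_left (k : ℝ) (a b : Fin 4 → ℝ) : wedge (k • a) b = k • wedge a b := by
  ext i j; simp [wedge]; ring

lemma wedge_smul_right (k : ℝ) (a b : Fin 4 → ℝ) : wedge a (k • b) = k • wedge a b := by
  ext i j; simp [wedge]; ring

lemma wedge_self (a : Fin 4 → ℝ) : wedge a a = 0 := by
  ext i j; simp [wedge]; ring

/-- The bilinear form attached to an element of `Λ²ℝ⁴`, seen as a matrix. -/
def bivectorForm (a b : Fin 4 → ℝ) (B : Fin 4 → Fin 4 → ℝ) : ℝ := ∑ i, ∑ j, a i * B i j * b j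

lemma bivectorForm_add (a b : Fin 4 → ℝ) (B C : Fin 4 → Fin 4 → ℝ) :
    bivectorForm a b (B + C) = bivectorForm a b B + bivectorForm a b C := by
  simp only [bivectorForm, Pi.add_apply, mul_add, add_mul, Finset.sum_add_distrib]

lemma bivectorForm_smul (a b : Fin 4 → ℝ) (k : ℝ) (B : Fin 4 → Fin 4 → ℝ) :
    bivectorForm a b (k • B) = k * bivectorForm a b B := by
  simp only [bivectorForm, Pi.smul_apply, smul_eq_mul, Finset.mul_sum]
  exact Finset.sum_congr rfl fun i _ => Finset.sum_congr rfl fun j _ => by ring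

lemma bivectorForm_wedge (a b p q : Fin 4 → ℝ) :
    bivectorForm a b (wedge p q) = (a ⬝ᵥ p) * (b ⬝ᵥ q) - (a ⬝ᵥ q) * (b ⬝ᵥ p) := by
  simp only [bivectorForm, wedge, dotProduct, Fin.sum_univ_four]
  ring

/-- For an orthonormal pair `r, t` in `ℝ³` with `n = r × t`, five of the six bivectors of the
induced basis of `Λ²ℝ⁴` are linearly independent. -/
lemma wedge_frame_coeff_eq {r t : Fin 3 → ℝ} (hrr : r ⬝ᵥ r = 1) (htt : t ⬝ᵥ t = 1)
    (hrt : r ⬝ᵥ t = 0) {c₁ c₂ c₃ c₄ c₅ d₁ d₂ : ℝ}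
    (h : c₁ • wedge (emb r) (emb t) + c₂ • wedge e4 (emb t)
      + c₃ • wedge (emb r) (emb (crossProduct r t)) + c₄ • wedge (emb t) (emb (crossProduct r t))
      + c₅ • wedge e4 (emb (crossProduct r t))
      = d₁ • wedge (emb r) (emb t) + d₂ • wedge e4 (emb t)) :
    c₁ = d₁ ∧ c₂ = d₂ ∧ c₃ = 0 ∧ c₄ = 0 ∧ c₅ = 0 := by
  have htr : t ⬝ᵥ r = 0 := by rw [dotProduct_comm, hrt]
  have hrn : r ⬝ᵥ crossProduct r t = 0 := dot_self_cross r t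
  have htn : t ⬝ᵥ crossProduct r t = 0 := dot_cross_self r t
  have hnr : crossProduct r t ⬝ᵥ r = 0 := by rw [dotProduct_comm, hrn]
  have hnt : crossProduct r t ⬝ᵥ t = 0 := by rw [dotProduct_comm, htn]
  have hnn : crossProduct r t ⬝ᵥ crossProduct r t = 1 := by
    rw [cross_dot_cross, hrr, htt, hrt, htr]; ring
  have key (a b : Fin 4 → ℝ) := congrArg (bivectorForm a b) h
  simp only [bivectorForm_add, bivectorForm_smul, bivectorForm_wedge] at key
  refine ⟨?_, ?_, ?_, ?_, ?_⟩
  · simpa [emb_dotProduct_emb, emb_dotProduct_e4, e4_dotProduct_emb, e4_dotProduct_e4, hrr, htt,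
      hrt, htr, hrn, htn, hnr, hnt, hnn] using key (emb r) (emb t)
  · simpa [emb_dotProduct_emb, emb_dotProduct_e4, e4_dotProduct_emb, e4_dotProduct_e4, hrr, htt,
      hrt, htr, hrn, htn, hnr, hnt, hnn] using key e4 (emb t)
  · simpa [emb_dotProduct_emb, emb_dotProduct_e4, e4_dotProduct_emb, e4_dotProduct_e4, hrr, htt,
      hrt, htr, hrn, htn, hnr, hnt, hnn] using key (emb r) (emb (crossProduct r t))
  · simpa [emb_dotProduct_emb, emb_dotProduct_e4, e4_dotProduct_emb, e4_dotProduct_e4, hrr, htt,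
      hrt, htr, hrn, htn, hnr, hnt, hnn] using key (emb t) (emb (crossProduct r t))
  · simpa [emb_dotProduct_emb, emb_dotProduct_e4, e4_dotProduct_emb, e4_dotProduct_e4, hrr, htt,
      hrt, htr, hrn, htn, hnr, hnt, hnn] using key e4 (emb (crossProduct r t))

/-- Expansion of a vector of `ℝ³` in the orthonormal frame `r, t, r × t`. -/
lemma eq_sum_orthonormal_frame {r t : Fin 3 → ℝ} (hrr : r ⬝ᵥ r = 1) (htt : t ⬝ᵥ t = 1)
    (hrt : r ⬝ᵥ t = 0) (w : Fin 3 → ℝ) :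
    w = (w ⬝ᵥ r) • r + (w ⬝ᵥ t) • t + (w ⬝ᵥ crossProduct r t) • crossProduct r t := by
  have htr : t ⬝ᵥ r = 0 := by rw [dotProduct_comm, hrt]
  have hrn : r ⬝ᵥ crossProduct r t = 0 := dot_self_cross r t
  have htn : t ⬝ᵥ crossProduct r t = 0 := dot_cross_self r t
  have hnr : crossProduct r t ⬝ᵥ r = 0 := by rw [dotProduct_comm, hrn]
  have hnt : crossProduct r t ⬝ᵥ t = 0 := by rw [dotProduct_comm, htn]
  have hnn : crossProduct r t ⬝ᵥ crossProduct r t = 1 := by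
    rw [cross_dot_cross, hrr, htt, hrt, htr]; ring
  set n := crossProduct r t
  let M : Matrix (Fin 3) (Fin 3) ℝ := Matrix.of ![r, t, n]
  have hM : M * Mᵀ = 1 := by
    ext i j
    change ![r, t, n] i ⬝ᵥ ![r, t, n] j = _
    fin_cases i <;> fin_cases j <;> simp [hrr, htt, hrt, htr, hrn, htn, hnr, hnt, hnn]
  have hM' : Mᵀ * M = 1 := mul_eq_one_comm.mp hM
  have hw : w = Mᵀ *ᵥ (M *ᵥ w) := by rw [mulVec_mulVec, hM', one_mulVec]
  conv_lhs => rw [hw]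
  ext i
  simp [M, mulVec, dotProduct, Fin.sum_univ_three]
  ring

/-! ### Derivatives -/

lemma HasDerivAt.dotProduct {ι : Type*} [Fintype ι] {a b : ℝ → ι → ℝ} {a' b' : ι → ℝ} {x : ℝ}
    (ha : HasDerivAt a a' x) (hb : HasDerivAt b b' x) :
    HasDerivAt (fun s => a s ⬝ᵥ b s) (a' ⬝ᵥ b x + a x ⬝ᵥ b') x := by
  rw [hasDerivAt_pi] at ha hb
  refine (HasDerivAt.fun_sum (u := Finset.univ) fun i _ => (ha i).fun_mul (hb i)).congr_deriv ?_
  simp only [_root_.dotProduct, Finset.sum_add_distrib]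

lemma HasDerivAt.crossProduct {a b : ℝ → Fin 3 → ℝ} {a' b' : Fin 3 → ℝ} {x : ℝ}
    (ha : HasDerivAt a a' x) (hb : HasDerivAt b b' x) :
    HasDerivAt (fun s => _root_.crossProduct (a s) (b s))
      (_root_.crossProduct a' (b x) + _root_.crossProduct (a x) b') x := by
  rw [hasDerivAt_pi] at ha hb ⊢
  intro i
  fin_cases i
  · refine (((ha 1).fun_mul (hb 2)).fun_sub ((ha 2).fun_mul (hb 1))).congr_deriv ?_
    simp [cross_apply]; ring
  · refine (((ha 2).fun_mul (hb 0)).fun_sub ((ha 0).fun_mul (hb 2))).congr_deriv ?_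
    simp [cross_apply]; ring
  · refine (((ha 0).fun_mul (hb 1)).fun_sub ((ha 1).fun_mul (hb 0))).congr_deriv ?_
    simp [cross_apply]; ring

lemma HasDerivAt.emb {a : ℝ → Fin 3 → ℝ} {a' : Fin 3 → ℝ} {x : ℝ} (ha : HasDerivAt a a' x) :
    HasDerivAt (fun s => _root_.emb (a s)) (_root_.emb a') x := by
  rw [hasDerivAt_pi] at ha ⊢
  intro i
  fin_cases i
  · exact ha 0
  · exact ha 1
  · exact ha 2
  · exact hasDerivAt_const x 0

lemma HasDerivAt.wedge {a b : ℝ → Fin 4 → ℝ} {a' b' : Fin 4 → ℝ} {x : ℝ}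
    (ha : HasDerivAt a a' x) (hb : HasDerivAt b b' x) :
    HasDerivAt (fun s => _root_.wedge (a s) (b s))
      (_root_.wedge a' (b x) + _root_.wedge (a x) b') x := by
  rw [hasDerivAt_pi] at ha hb ⊢
  intro i
  rw [hasDerivAt_pi]
  intro j
  refine (((ha i).fun_mul (hb j)).fun_sub ((ha j).fun_mul (hb i))).congr_deriv ?_
  simp [_root_.wedge]; ring

section Smooth

variable {E : Type*} [NormedAddCommGroup E] [NormedSpace ℝ E] {S : Set ℝ} {h : ℝ → E}

lemma ContDiffOn.hasDerivAt_deriv (hS : IsOpen S) (hh : ContDiffOn ℝ (⊤ : ℕ∞) h S) {x : ℝ}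
    (hx : x ∈ S) : HasDerivAt h (deriv h x) x :=
  ((hh.contDiffAt (hS.mem_nhds hx)).differentiableAt (by simp)).hasDerivAt

lemma ContDiffOn.smooth_deriv (hS : IsOpen S) (hh : ContDiffOn ℝ (⊤ : ℕ∞) h S) :
    ContDiffOn ℝ (⊤ : ℕ∞) (deriv h) S :=
  hh.deriv_of_isOpen hS (by simp)

lemma deriv_deriv_eq_of_hasDerivAt (hS : IsOpen S) {h' : ℝ → E} {h'' : E} {x : ℝ} (hx : x ∈ S)
    (h₁ : ∀ s ∈ S, HasDerivAt h (h' s) s) (h₂ : HasDerivAt h' h'' x) :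
    deriv (deriv h) x = h'' := by
  have he : deriv h =ᶠ[nhds x] h' := by
    filter_upwards [hS.mem_nhds hx] with s hs using (h₁ s hs).deriv
  rw [he.deriv_eq, h₂.deriv]

lemma deriv_eq_zero_of_const (hS : IsOpen S) {c : E} (hc : ∀ s ∈ S, h s = c) {x : ℝ}
    (hx : x ∈ S) : deriv h x = 0 := by
  have he : h =ᶠ[nhds x] fun _ => c := by
    filter_upwards [hS.mem_nhds hx] with s hs using hc s hs
  rw [he.deriv_eq, deriv_const]

lemma exists_const_of_deriv_eq_zero (hS : IsOpen S) (hSc : S.OrdConnected)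
    (hSne : S.Nonempty) (hd : ∀ s ∈ S, HasDerivAt h 0 s) : ∃ c, ∀ s ∈ S, h s = c := by
  obtain ⟨x, hx⟩ := hSne
  refine ⟨h x, fun s hs => ?_⟩
  exact hS.is_const_of_deriv_eq_zero hSc.isPreconnected
    (fun y hy => (hd y hy).differentiableAt.differentiableWithinAt)
    (fun y hy => (hd y hy).deriv) hs hx

end Smooth

/-! ### Spherical curves -/

section Curve

variable {J : Set ℝ} {r : ℝ → Fin 3 → ℝ}

lemma dotProduct_deriv_eq_zero (hJ : IsOpen J) (hr : ContDiffOn ℝ (⊤ : ℕ∞) r J) {c : ℝ}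
    (hrs : ∀ v ∈ J, r v ⬝ᵥ r v = c) {v : ℝ} (hv : v ∈ J) : r v ⬝ᵥ deriv r v = 0 := by
  have hd := hr.hasDerivAt_deriv hJ hv
  have h := deriv_eq_zero_of_const hJ hrs hv
  rw [(hd.dotProduct hd).deriv, dotProduct_comm (deriv r v)] at h
  linarith

lemma deriv_deriv_eq_sphCurv (hJ : IsOpen J) (hr : ContDiffOn ℝ (⊤ : ℕ∞) r J)
    (hrs : ∀ v ∈ J, r v ⬝ᵥ r v = 1) (hra : ∀ v ∈ J, deriv r v ⬝ᵥ deriv r v = 1)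
    {v : ℝ} (hv : v ∈ J) :
    deriv (deriv r) v = sphCurv r v • sphN r v + (-1 : ℝ) • r v := by
  have hrt : ∀ s ∈ J, r s ⬝ᵥ deriv r s = 0 := fun s hs => dotProduct_deriv_eq_zero hJ hr hrs hs
  have hr' := hr.smooth_deriv hJ
  have htt' := dotProduct_deriv_eq_zero hJ hr' hra hv
  have h := deriv_eq_zero_of_const hJ hrt hv
  rw [((hr.hasDerivAt_deriv hJ hv).dotProduct (hr'.hasDerivAt_deriv hJ hv)).deriv, hra v hv] at h
  have hrr' : deriv (deriv r) v ⬝ᵥ r v = -1 := by rw [dotProduct_comm]; linarith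
  have hw := eq_sum_orthonormal_frame (hrs v hv) (hra v hv) (hrt v hv) (deriv (deriv r) v)
  rw [hrr', dotProduct_comm (deriv (deriv r) v) (deriv r v), htt'] at hw
  rw [hw, sphCurv, sphN]
  simp [add_comm]

lemma hasDerivAt_sphN (hJ : IsOpen J) (hr : ContDiffOn ℝ (⊤ : ℕ∞) r J)
    (hrs : ∀ v ∈ J, r v ⬝ᵥ r v = 1) (hra : ∀ v ∈ J, deriv r v ⬝ᵥ deriv r v = 1)
    {v : ℝ} (hv : v ∈ J) : HasDerivAt (sphN r) (-(sphCurv r v) • deriv r v) v := by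
  have hd := (hr.hasDerivAt_deriv hJ hv).crossProduct ((hr.smooth_deriv hJ).hasDerivAt_deriv hJ hv)
  refine hd.congr_deriv ?_
  rw [deriv_deriv_eq_sphCurv hJ hr hrs hra hv, cross_self, map_add, map_smul, map_smul, cross_self,
    sphN]
  have h1 := hrs v hv
  have h2 := dotProduct_deriv_eq_zero hJ hr hrs hv
  simp only [dotProduct, Fin.sum_univ_three] at h1 h2
  ext i
  fin_cases i <;> simp [cross_apply]
  · linear_combination sphCurv r v * r v 0 * h2 - sphCurv r v * deriv r v 0 * h1
  · linear_combination sphCurv r v * r v 1 * h2 - sphCurv r v * deriv r v 1 * h1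
  · linear_combination sphCurv r v * r v 2 * h2 - sphCurv r v * deriv r v 2 * h1

lemma hasDerivAt_sphCurv (hJ : IsOpen J) (hr : ContDiffOn ℝ (⊤ : ℕ∞) r J)
    (hrs : ∀ v ∈ J, r v ⬝ᵥ r v = 1) (hra : ∀ v ∈ J, deriv r v ⬝ᵥ deriv r v = 1)
    {v : ℝ} (hv : v ∈ J) : HasDerivAt (sphCurv r) (deriv (sphCurv r) v) v :=
  (HasDerivAt.dotProduct (((hr.smooth_deriv hJ).smooth_deriv hJ).hasDerivAt_deriv hJ hv)
    (hasDerivAt_sphN hJ hr hrs hra hv)).differentiableAt.hasDerivAt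

/-! ### The Laplacian of the Gauss map -/

variable {I : Set ℝ} {f g : ℝ → ℝ}

lemma gaussG_eq (u v : ℝ) : gaussG f g r u v =
    deriv f u • wedge (emb (r v)) (emb (deriv r v)) + deriv g u • wedge e4 (emb (deriv r v)) := by
  simp only [gaussG, mx, my, wedge_add_left, wedge_smul_left]

lemma surfLap_gaussG (hI : IsOpen I) (hJ : IsOpen J)
    (hr : ContDiffOn ℝ (⊤ : ℕ∞) r J)
    (hrs : ∀ v ∈ J, r v ⬝ᵥ r v = 1) (hra : ∀ v ∈ J, deriv r v ⬝ᵥ deriv r v = 1)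
    (hf : ContDiffOn ℝ (⊤ : ℕ∞) f I) (hg : ContDiffOn ℝ (⊤ : ℕ∞) g I)
    {u v : ℝ} (hu : u ∈ I) (hv : v ∈ J) :
    surfLap f (gaussG f g r) u v =
      (-deriv (deriv (deriv f)) u + deriv f u * sphCurv r v ^ 2 / f u ^ 2
        - deriv f u * deriv (deriv f) u / f u) • wedge (emb (r v)) (emb (deriv r v))
      + (-deriv (deriv (deriv g)) u + deriv g u * (1 + sphCurv r v ^ 2) / f u ^ 2
        - deriv f u * deriv (deriv g) u / f u) • wedge e4 (emb (deriv r v))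
      + (-(deriv f u * deriv (sphCurv r) v / f u ^ 2)) • wedge (emb (r v)) (emb (sphN r v))
      + (-(deriv f u * sphCurv r v / f u ^ 2)) • wedge (emb (deriv r v)) (emb (sphN r v))
      + (-(deriv g u * deriv (sphCurv r) v / f u ^ 2)) • wedge e4 (emb (sphN r v)) := by
  have hf1 := hf.smooth_deriv hI
  have hg1 := hg.smooth_deriv hI
  have hU₁ : ∀ s ∈ I, HasDerivAt (fun s => gaussG f g r s v)
      (deriv (deriv f) s • wedge (emb (r v)) (emb (deriv r v))
        + deriv (deriv g) s • wedge e4 (emb (deriv r v))) s := fun s hs => by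
    simp only [gaussG_eq]
    exact ((hf1.hasDerivAt_deriv hI hs).smul_const _).add
      ((hg1.hasDerivAt_deriv hI hs).smul_const _)
  have hU₂ := deriv_deriv_eq_of_hasDerivAt hI hu hU₁
    ((((hf1.smooth_deriv hI).hasDerivAt_deriv hI hu).smul_const _).add
      (((hg1.smooth_deriv hI).hasDerivAt_deriv hI hu).smul_const _))
  have hR : ∀ s ∈ J, HasDerivAt (fun s => emb (r s)) (emb (deriv r s)) s := fun s hs =>
    (hr.hasDerivAt_deriv hJ hs).emb
  have hT : ∀ s ∈ J, HasDerivAt (fun s => emb (deriv r s))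
      (sphCurv r s • emb (sphN r s) + (-1 : ℝ) • emb (r s)) s := fun s hs => by
    rw [← emb_smul, ← emb_smul, ← emb_add, ← deriv_deriv_eq_sphCurv hJ hr hrs hra hs]
    exact ((hr.smooth_deriv hJ).hasDerivAt_deriv hJ hs).emb
  have hN : HasDerivAt (fun s => emb (sphN r s)) (-(sphCurv r v) • emb (deriv r v)) v := by
    rw [← emb_smul]
    exact (hasDerivAt_sphN hJ hr hrs hra hv).emb
  have hK := hasDerivAt_sphCurv hJ hr hrs hra hv
  have hE : ∀ s : ℝ, HasDerivAt (fun _ : ℝ => e4) 0 s := fun s => hasDerivAt_const s e4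
  have h0 (b : Fin 4 → ℝ) : wedge 0 b = 0 := by ext i j; simp [wedge]
  have hV₁ : ∀ s ∈ J, HasDerivAt (fun s => gaussG f g r u s)
      (deriv f u • (sphCurv r s • wedge (emb (r s)) (emb (sphN r s)))
        + deriv g u • (sphCurv r s • wedge e4 (emb (sphN r s))
          + (-1 : ℝ) • wedge e4 (emb (r s)))) s := fun s hs => by
    rw [show (fun s => gaussG f g r u s) = _ from funext fun s => gaussG_eq u s]
    refine ((((hR s hs).wedge (hT s hs)).const_smul (deriv f u)).add
      (((hE s).wedge (hT s hs)).const_smul (deriv g u))).congr_deriv ?_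
    simp only [wedge_add_right, wedge_smul_right, wedge_self, h0, smul_zero, add_zero, zero_add]
  have hV₂ := deriv_deriv_eq_of_hasDerivAt hJ hv hV₁
    (((hK.smul ((hR v hv).wedge hN)).const_smul (deriv f u)).add
      (((hK.smul ((hE v).wedge hN)).add
        (((hE v).wedge (hR v hv)).const_smul (-1 : ℝ))).const_smul (deriv g u)))
  rw [surfLap, hU₂, hV₂, (hU₁ u hu).deriv]
  simp only [wedge_smul_right, h0, zero_add]
  module

lemma surfLap_gaussG_eq_smul_iff (hI : IsOpen I) (hJ : IsOpen J)
    (hr : ContDiffOn ℝ (⊤ : ℕ∞) r J)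
    (hrs : ∀ v ∈ J, r v ⬝ᵥ r v = 1) (hra : ∀ v ∈ J, deriv r v ⬝ᵥ deriv r v = 1)
    (hf : ContDiffOn ℝ (⊤ : ℕ∞) f I) (hg : ContDiffOn ℝ (⊤ : ℕ∞) g I)
    {u v : ℝ} (hu : u ∈ I) (hv : v ∈ J) (hfu : f u ≠ 0) (hgu : deriv g u ≠ 0) (c : ℝ) :
    surfLap f (gaussG f g r) u v = c • gaussG f g r u v ↔
      deriv (sphCurv r) v = 0 ∧ deriv f u * sphCurv r v = 0 ∧
      -deriv (deriv (deriv f)) u - deriv f u * deriv (deriv f) u / f u = c * deriv f u ∧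
      -deriv (deriv (deriv g)) u + deriv g u * (1 + sphCurv r v ^ 2) / f u ^ 2
        - deriv f u * deriv (deriv g) u / f u = c * deriv g u := by
  rw [surfLap_gaussG hI hJ hr hrs hra hf hg hu hv, gaussG_eq]
  constructor
  · intro h
    rw [smul_add, smul_smul, smul_smul] at h
    obtain ⟨h1, h2, -, h4, h5⟩ := wedge_frame_coeff_eq (hrs v hv) (hra v hv)
      (dotProduct_deriv_eq_zero hJ hr hrs hv) h
    have h4' : deriv f u * sphCurv r v = 0 := by simpa [hfu] using h4
    refine ⟨by simpa [hfu, hgu] using h5, h4', ?_, by linarith⟩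
    have : deriv f u * sphCurv r v ^ 2 = 0 := by rw [pow_two, ← mul_assoc, h4', zero_mul]
    rw [this, zero_div] at h1
    linarith
  · rintro ⟨h1, h2, h3, h4⟩
    have h5 : deriv f u * sphCurv r v ^ 2 = 0 := by rw [pow_two, ← mul_assoc, h2, zero_mul]
    rw [h4, h1, h2, h5, zero_div, add_zero, h3]
    module

/-! ### The meridian curve -/

lemma hasDerivAt_merCurv (hI : IsOpen I) (hf : ContDiffOn ℝ (⊤ : ℕ∞) f I)
    (hg : ContDiffOn ℝ (⊤ : ℕ∞) g I) {u : ℝ} (hu : u ∈ I) :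
    HasDerivAt (merCurv f g)
      (deriv f u * deriv (deriv (deriv g)) u - deriv g u * deriv (deriv (deriv f)) u) u := by
  have hf1 := hf.smooth_deriv hI
  have hg1 := hg.smooth_deriv hI
  refine (((hf1.hasDerivAt_deriv hI hu).mul ((hg1.smooth_deriv hI).hasDerivAt_deriv hI hu)).sub
    ((hg1.hasDerivAt_deriv hI hu).mul
      ((hf1.smooth_deriv hI).hasDerivAt_deriv hI hu))).congr_deriv ?_
  ring

lemma deriv_mul_merCurv (hI : IsOpen I) (hf : ContDiffOn ℝ (⊤ : ℕ∞) f I)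
    (hg : ContDiffOn ℝ (⊤ : ℕ∞) g I) {u : ℝ} (hu : u ∈ I) :
    deriv (fun s => f s * merCurv f g s) u = deriv f u * merCurv f g u
      + f u * (deriv f u * deriv (deriv (deriv g)) u - deriv g u * deriv (deriv (deriv f)) u) :=
  ((hf.hasDerivAt_deriv hI hu).mul (hasDerivAt_merCurv hI hf hg hu)).deriv

/-- The first two derivatives of the arc length condition `f′² + g′² = 1`. -/
lemma arclength_deriv_relations (hI : IsOpen I) (hf : ContDiffOn ℝ (⊤ : ℕ∞) f I)
    (hg : ContDiffOn ℝ (⊤ : ℕ∞) g I) (hfg : ∀ u ∈ I, deriv f u ^ 2 + deriv g u ^ 2 = 1)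
    {u : ℝ} (hu : u ∈ I) :
    deriv f u * deriv (deriv f) u + deriv g u * deriv (deriv g) u = 0 ∧
      deriv f u * deriv (deriv (deriv f)) u + deriv g u * deriv (deriv (deriv g)) u
        = -(deriv (deriv f) u ^ 2 + deriv (deriv g) u ^ 2) := by
  have hf1 := hf.smooth_deriv hI
  have hg1 := hg.smooth_deriv hI
  have h1 : ∀ s ∈ I,
      deriv f s * deriv (deriv f) s + deriv g s * deriv (deriv g) s = 0 := fun s hs => by
    have h := deriv_eq_zero_of_const hI hfg hs
    have hd := ((hf1.hasDerivAt_deriv hI hs).pow 2).add ((hg1.hasDerivAt_deriv hI hs).pow 2)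
    have h' := hd.deriv.symm.trans h
    norm_num at h'
    linarith
  refine ⟨h1 u hu, ?_⟩
  have h := deriv_eq_zero_of_const hI h1 hu
  have hd := ((hf1.hasDerivAt_deriv hI hu).mul ((hf1.smooth_deriv hI).hasDerivAt_deriv hI hu)).add
    ((hg1.hasDerivAt_deriv hI hu).mul ((hg1.smooth_deriv hI).hasDerivAt_deriv hI hu))
  have h' := hd.deriv.symm.trans h
  linarith

/-- A unit speed curve `(f, g)` with `f′ = 0` is a vertical line run through at unit speed. -/
lemma exists_line_of_deriv_eq_zero (hI : IsOpen I) (hIc : I.OrdConnected) (hIne : I.Nonempty)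
    (hf : ContDiffOn ℝ (⊤ : ℕ∞) f I) (hg : ContDiffOn ℝ (⊤ : ℕ∞) g I)
    (hfg : ∀ u ∈ I, deriv f u ^ 2 + deriv g u ^ 2 = 1) (hf' : ∀ u ∈ I, deriv f u = 0) :
    ∃ a b : ℝ, (∀ u ∈ I, f u = a) ∧ ((∀ u ∈ I, g u = u + b) ∨ ∀ u ∈ I, g u = -u + b) := by
  have hg1 := hg.smooth_deriv hI
  have hg2 : ∀ u ∈ I, deriv g u ^ 2 = 1 := fun u hu => by
    have := hfg u hu
    rw [hf' u hu] at this
    linarith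
  obtain ⟨a, ha⟩ := exists_const_of_deriv_eq_zero hI hIc hIne fun u hu => by
    simpa only [hf' u hu] using hf.hasDerivAt_deriv hI hu
  obtain ⟨c, hc⟩ := exists_const_of_deriv_eq_zero (h := deriv g) hI hIc hIne fun u hu => by
    have h := (arclength_deriv_relations hI hf hg hfg hu).1
    have hne : deriv g u ≠ 0 := fun h0 => by simpa [h0] using hg2 u hu
    rw [hf' u hu, zero_mul, zero_add] at h
    simpa only [(mul_eq_zero.mp h).resolve_left hne] using hg1.hasDerivAt_deriv hI hu
  obtain ⟨b, hb⟩ := exists_const_of_deriv_eq_zero (h := fun u => g u - c * u) hI hIc hIne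
    fun u hu => by
      refine ((hg.hasDerivAt_deriv hI hu).fun_sub
        ((hasDerivAt_id' u).const_mul c)).congr_deriv ?_
      rw [hc u hu]
      ring
  obtain ⟨x, hx⟩ := hIne
  have hc2 : c ^ 2 = 1 := by rw [← hc x hx, hg2 x hx]
  refine ⟨a, b, ha, (eq_or_eq_neg_of_sq_eq_sq c 1 (by rw [hc2, one_pow])).imp
    (fun h u hu => ?_) fun h u hu => ?_⟩ <;>
  · have := hb u hu
    rw [h] at this
    linarith

end Curve

/-- For `g′ ≠ 0` everywhere: the meridian surface has pointwise 1-type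
Gauss map of the first kind (`ΔG = λG`) iff (i) `κ ≡ 0` and `f′g′ − f(fκ_α)′ = 0`, or
(ii) `κ` is a nonzero constant and `f ≡ a`, `g(u) = ±u + b`; in case (ii)
`λ = (1 + κ²)/a²` is constant, so the Gauss map is of (global) 1-type and non-proper. -/
theorem meridian_surface_first_kind_iff_of_g_deriv_ne_zero
    (I J : Set ℝ) (hI : IsOpen I) (hIiv : I.OrdConnected) (hIne : I.Nonempty)
    (hJ : IsOpen J) (hJiv : J.OrdConnected) (hJne : J.Nonempty)
    (r : ℝ → Fin 3 → ℝ) (hr : ContDiffOn ℝ (⊤ : ℕ∞) r J)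
    (hrs : ∀ v ∈ J, r v ⬝ᵥ r v = 1) (hra : ∀ v ∈ J, deriv r v ⬝ᵥ deriv r v = 1)
    (f g : ℝ → ℝ) (hf : ContDiffOn ℝ (⊤ : ℕ∞) f I) (hg : ContDiffOn ℝ (⊤ : ℕ∞) g I)
    (hf0 : ∀ u ∈ I, f u ≠ 0) (hfg : ∀ u ∈ I, deriv f u ^ 2 + deriv g u ^ 2 = 1)
    (hg' : ∀ u ∈ I, deriv g u ≠ 0) :
    ((∃ lam : ℝ → ℝ → ℝ,
        ContDiffOn ℝ (⊤ : ℕ∞) (Function.uncurry lam) (I ×ˢ J) ∧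
        (∀ u ∈ I, ∀ v ∈ J, lam u v ≠ 0) ∧
        ∀ u ∈ I, ∀ v ∈ J, surfLap f (gaussG f g r) u v = lam u v • gaussG f g r u v) ↔
      (((∀ v ∈ J, sphCurv r v = 0) ∧
          ∀ u ∈ I, deriv f u * deriv g u - f u * deriv (fun s => f s * merCurv f g s) u = 0) ∨
        (∃ κ₀ a b : ℝ, κ₀ ≠ 0 ∧ (∀ v ∈ J, sphCurv r v = κ₀) ∧ a ≠ 0 ∧
          (∀ u ∈ I, f u = a) ∧ ((∀ u ∈ I, g u = u + b) ∨ ∀ u ∈ I, g u = -u + b)))) ∧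
    (∀ κ₀ a b : ℝ, κ₀ ≠ 0 → (∀ v ∈ J, sphCurv r v = κ₀) → a ≠ 0 →
      (∀ u ∈ I, f u = a) → ((∀ u ∈ I, g u = u + b) ∨ ∀ u ∈ I, g u = -u + b) →
      ∀ u ∈ I, ∀ v ∈ J,
        surfLap f (gaussG f g r) u v = ((1 + κ₀ ^ 2) / a ^ 2) • gaussG f g r u v) := by
  have hlin : ∀ κ₀ a b : ℝ, κ₀ ≠ 0 → (∀ v ∈ J, sphCurv r v = κ₀) → a ≠ 0 →
      (∀ u ∈ I, f u = a) → ((∀ u ∈ I, g u = u + b) ∨ ∀ u ∈ I, g u = -u + b) →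
      ∀ u ∈ I, ∀ v ∈ J,
        surfLap f (gaussG f g r) u v = ((1 + κ₀ ^ 2) / a ^ 2) • gaussG f g r u v := by
    intro κ₀ a b _ hκ _ hfa hgb u hu v hv
    have hf1 : ∀ s ∈ I, deriv f s = 0 := fun s hs => deriv_eq_zero_of_const hI hfa hs
    have hf2 : ∀ s ∈ I, deriv (deriv f) s = 0 := fun s hs => deriv_eq_zero_of_const hI hf1 hs
    have hf3 := deriv_eq_zero_of_const hI hf2 hu
    have hg2 : ∀ s ∈ I, deriv (deriv g) s = 0 := fun s hs => by
      have h := (arclength_deriv_relations hI hf hg hfg hs).1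
      simpa [hf1 s hs, hg' s hs] using h
    have hg3 := deriv_eq_zero_of_const hI hg2 hu
    rw [surfLap_gaussG_eq_smul_iff hI hJ hr hrs hra hf hg hu hv (hf0 u hu) (hg' u hu)]
    refine ⟨deriv_eq_zero_of_const hJ hκ hv, by simp [hf1 u hu], by simp [hf1 u hu, hf3], ?_⟩
    rw [hf1 u hu, hg3, hκ v hv, hfa u hu]
    ring
  refine ⟨⟨?_, ?_⟩, hlin⟩
  · rintro ⟨lam, -, -, hlam⟩
    have key := fun u hu v hv => (surfLap_gaussG_eq_smul_iff hI hJ hr hrs hra hf hg hu hv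
      (hf0 u hu) (hg' u hu) _).mp (hlam u hu v hv)
    obtain ⟨u₀, hu₀⟩ := hIne
    obtain ⟨v₀, hv₀⟩ := hJne
    obtain ⟨κ₀, hκ⟩ := exists_const_of_deriv_eq_zero hJ hJiv ⟨v₀, hv₀⟩ fun v hv => by
      simpa only [(key u₀ hu₀ v hv).1] using hasDerivAt_sphCurv hJ hr hrs hra hv
    rcases eq_or_ne κ₀ 0 with rfl | hκ₀
    · refine Or.inl ⟨hκ, fun u hu => ?_⟩
      obtain ⟨-, -, h3, h4⟩ := key u hu v₀ hv₀
      have hfu := hf0 u hu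
      rw [deriv_mul_merCurv hI hf hg hu, merCurv]
      rw [hκ v₀ hv₀] at h4
      field_simp at h3 h4
      linear_combination deriv f u * h4 - f u * deriv g u * h3
    · have hf' : ∀ u ∈ I, deriv f u = 0 := fun u hu => by
        simpa [hκ v₀ hv₀, hκ₀] using (key u hu v₀ hv₀).2.1
      obtain ⟨a, b, hfa, hgb⟩ := exists_line_of_deriv_eq_zero hI hIiv ⟨u₀, hu₀⟩ hf hg hfg hf'
      exact Or.inr ⟨κ₀, a, b, hκ₀, hκ, hfa u₀ hu₀ ▸ hf0 u₀ hu₀, hfa, hgb⟩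
  · rintro (⟨hκ, hode⟩ | ⟨κ₀, a, b, hκ₀, hκ, ha, hfa, hgb⟩)
    · have hf1 := hf.smooth_deriv hI
      have hg1 := hg.smooth_deriv hI
      refine ⟨fun u _ => merCurv f g u ^ 2 + (deriv g u / f u) ^ 2, ?_, fun u hu v _ => ?_,
        fun u hu v hv => ?_⟩
      · have hm : ContDiffOn ℝ (⊤ : ℕ∞)
            (fun u => merCurv f g u ^ 2 + (deriv g u / f u) ^ 2) I :=
          (((hf1.mul (hg1.smooth_deriv hI)).sub (hg1.mul (hf1.smooth_deriv hI))).pow 2).add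
            ((hg1.div hf hf0).pow 2)
        exact hm.comp contDiffOn_fst fun p hp => hp.1
      · have := div_ne_zero (hg' u hu) (hf0 u hu)
        positivity
      · rw [surfLap_gaussG_eq_smul_iff hI hJ hr hrs hra hf hg hu hv (hf0 u hu) (hg' u hu)]
        have hfu := hf0 u hu
        have h0 := hfg u hu
        obtain ⟨h1, h2⟩ := arclength_deriv_relations hI hf hg hfg hu
        have ho := hode u hu
        rw [deriv_mul_merCurv hI hf hg hu, merCurv] at ho
        refine ⟨deriv_eq_zero_of_const hJ hκ hv, by simp [hκ v hv], ?_, ?_⟩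
        · simp only [merCurv]
          field_simp
          linear_combination (f u ^ 2 * deriv (deriv (deriv f)) u
            + f u * deriv f u * deriv (deriv f) u) * h0
            + deriv f u * (-f u ^ 2 * h2 + f u ^ 2 * (deriv f u * deriv (deriv f) u
              + deriv g u * deriv (deriv g) u) * h1
              - f u ^ 2 * (deriv (deriv f) u ^ 2 + deriv (deriv g) u ^ 2) * h0
              - f u * deriv f u * h1)
            - deriv g u * ho
        · simp only [merCurv, hκ v hv]
          field_simp
          linear_combination (f u ^ 2 * deriv (deriv (deriv g)) u - deriv g u
            + f u * deriv f u * deriv (deriv g) u) * h0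
            + deriv g u * (-f u ^ 2 * h2 + f u ^ 2 * (deriv f u * deriv (deriv f) u
              + deriv g u * deriv (deriv g) u) * h1
              - f u ^ 2 * (deriv (deriv f) u ^ 2 + deriv (deriv g) u ^ 2) * h0
              - f u * deriv f u * h1)
            + deriv f u * ho
    · refine ⟨fun _ _ => (1 + κ₀ ^ 2) / a ^ 2, contDiffOn_const, fun _ _ _ _ => by positivity,
        hlin κ₀ a b hκ₀ hκ ha hfa hgb⟩
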